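/- For an odd prime p, there exist integers x, y with 2p = x² + 5y² if and only if there exist integers x, y with p = 2x² + 2xy + 3y². -/

import Mathlib

theorem stmt_6 (p : ℕ) (hp : Nat.Prime p) (hodd : Odd p) :
    (∃ x y : ℤ, 2*(p : ℤ) = x^2 + 5*y^2) ↔ (∃ x y : ℤ, (p : ℤ) = 2*x^2 + 2*x*y + 3*y^2) := by
  constructor
  · rintro ⟨x, y, h⟩
    have h1 : Even (x^2 + 5*y^2) := ⟨p, by rw [← h]; ring⟩
    have h2 : Even (x - y) := by
      have h5 : ¬ Even (5 : ℤ) := by decide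
      simp only [Int.even_add, Int.even_mul, Int.even_pow, Int.even_sub] at h1 ⊢
      tauto
    obtain ⟨k, hk⟩ := h2
    obtain rfl : x = 2*k + y := by linarith
    exact ⟨k, y, by linarith⟩
  · rintro ⟨x, y, h⟩
    exact ⟨2*x + y, y, by rw [h]; ring⟩
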